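/- Strong normalization of combined detour and permutation reduction: the λ^{□→∧∨}-calculus is strongly normalizing with respect to the reduction relation induced by the union of the detour-conversions >_D and the permutation-conversions >_P on well-typed terms, i.e. there is no infinite sequence of >_D- and >_P-steps starting from a term typable in some context. -/

import Mathlib

namespace IEL

/-- de Bruijn lifting of a renaming under `n` extra binders. -/
def liftRen (n : ℕ) (f : ℕ → ℕ) : ℕ → ℕ :=
  fun j => if j < n then j else f (j - n) + n

/-- Terms of the calculus `λ^{□→∧∨}` in de Bruijn representation.
In `box ts s`, the body `s` is under `ts.length` binders: de Bruijn index `j` in `s`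
refers to the binding for `ts[ts.length - 1 - j]` (i.e. `x₁` is the outermost binder). -/
inductive Tm : Type where
  | var : ℕ → Tm
  | lam : Tm → Tm
  | app : Tm → Tm → Tm
  | pair : Tm → Tm → Tm
  | proj1 : Tm → Tm
  | proj2 : Tm → Tm
  | inl : Tm → Tm
  | inr : Tm → Tm
  | case : Tm → Tm → Tm → Tm
  | box : List Tm → Tm → Tm

def Tm.rename (f : ℕ → ℕ) : Tm → Tm
  | .var n => .var (f n)
  | .lam t => .lam (t.rename (liftRen 1 f))
  | .app t s => .app (t.rename f) (s.rename f)
  | .pair t s => .pair (t.rename f) (s.rename f)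
  | .proj1 t => .proj1 (t.rename f)
  | .proj2 t => .proj2 (t.rename f)
  | .inl t => .inl (t.rename f)
  | .inr t => .inr (t.rename f)
  | .case t a b => .case (t.rename f) (a.rename (liftRen 1 f)) (b.rename (liftRen 1 f))
  | .box ts s => .box (ts.attach.map fun x => x.1.rename f) (s.rename (liftRen ts.length f))
termination_by t => sizeOf t
decreasing_by all_goals simp_wf <;> ((try have := List.sizeOf_lt_of_mem x.2); omega)

def liftSub (n : ℕ) (σ : ℕ → Tm) : ℕ → Tm :=
  fun j => if j < n then .var j else (σ (j - n)).rename (· + n)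

def Tm.subst (σ : ℕ → Tm) : Tm → Tm
  | .var n => σ n
  | .lam t => .lam (t.subst (liftSub 1 σ))
  | .app t s => .app (t.subst σ) (s.subst σ)
  | .pair t s => .pair (t.subst σ) (s.subst σ)
  | .proj1 t => .proj1 (t.subst σ)
  | .proj2 t => .proj2 (t.subst σ)
  | .inl t => .inl (t.subst σ)
  | .inr t => .inr (t.subst σ)
  | .case t a b => .case (t.subst σ) (a.subst (liftSub 1 σ)) (b.subst (liftSub 1 σ))
  | .box ts s => .box (ts.attach.map fun x => x.1.subst σ) (s.subst (liftSub ts.length σ))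
termination_by t => sizeOf t
decreasing_by all_goals simp_wf <;> ((try have := List.sizeOf_lt_of_mem x.2); omega)

/-- `t.subst1 s` is `t[x₀ := s]`. -/
def Tm.subst1 (t s : Tm) : Tm :=
  t.subst (fun j => match j with | 0 => s | j+1 => .var j)

/-- Compatible (contextual) closure of a base relation `R`. -/
inductive Compat (R : Tm → Tm → Prop) : Tm → Tm → Prop where
  | base {t s} : R t s → Compat R t s
  | lam {t t'} : Compat R t t' → Compat R (.lam t) (.lam t')
  | appL {t t' s} : Compat R t t' → Compat R (.app t s) (.app t' s)
  | appR {t s s'} : Compat R s s' → Compat R (.app t s) (.app t s')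
  | pairL {t t' s} : Compat R t t' → Compat R (.pair t s) (.pair t' s)
  | pairR {t s s'} : Compat R s s' → Compat R (.pair t s) (.pair t s')
  | proj1 {t t'} : Compat R t t' → Compat R (.proj1 t) (.proj1 t')
  | proj2 {t t'} : Compat R t t' → Compat R (.proj2 t) (.proj2 t')
  | inl {t t'} : Compat R t t' → Compat R (.inl t) (.inl t')
  | inr {t t'} : Compat R t t' → Compat R (.inr t) (.inr t')
  | case1 {t t' a b} : Compat R t t' → Compat R (.case t a b) (.case t' a b)
  | case2 {t a a' b} : Compat R a a' → Compat R (.case t a b) (.case t a' b)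
  | case3 {t a b b'} : Compat R b b' → Compat R (.case t a b) (.case t a b')
  | boxArg {t t' l₁ l₂ s} : Compat R t t' →
      Compat R (.box (l₁ ++ t :: l₂) s) (.box (l₁ ++ t' :: l₂) s)
  | boxBody {ts s s'} : Compat R s s' → Compat R (.box ts s) (.box ts s')

/-- Renaming used when the body `v` of an inner box is substituted into the outer body:
`v` has `m` bound variables (sent to positions `i, …, i+m-1`) and its ambient free
variables are shifted below the `n - 1 + m` binders of the contractum. -/
def boxRho (i m n : ℕ) : ℕ → ℕ := fun k => if k < m then i + k else k + n - 1

/-- The substitution performed in the box/box detour: the bound variable at de Bruijn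
index `i` is replaced by `v` (suitably renamed), the remaining bound variables are
re-addressed for the enlarged binder list. -/
def boxSigma (i m n : ℕ) (v : Tm) : ℕ → Tm :=
  fun j => if j < i then .var j else if j = i then v.rename (boxRho i m n) else .var (j + m - 1)

/-- Root detour conversions. -/
inductive DRed : Tm → Tm → Prop where
  | beta {t s} : DRed (.app (.lam t) s) (t.subst1 s)
  | projPair1 {t s} : DRed (.proj1 (.pair t s)) t
  | projPair2 {t s} : DRed (.proj2 (.pair t s)) s
  | caseInl {t a b} : DRed (.case (.inl t) a b) (a.subst1 t)
  | caseInr {t a b} : DRed (.case (.inr t) a b) (b.subst1 t)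
  | boxBox {l₁ l₂ us v r} :
      DRed (.box (l₁ ++ (.box us v) :: l₂) r)
           (.box (l₁ ++ us ++ l₂)
                 (r.subst (boxSigma l₂.length us.length (l₁.length + 1 + l₂.length) v)))
  | boxVar {t} : DRed (.box [t] (.var 0)) t

/-- One-step detour reduction `>_D`: the compatible closure of the root detours. -/
def StepD : Tm → Tm → Prop := Compat DRed

/-- Root permutation conversions. -/
inductive PRed : Tm → Tm → Prop where
  | appCase {t a b s} : PRed (.app (.case t a b) s)
      (.case t (.app a (s.rename (· + 1))) (.app b (s.rename (· + 1))))
  | proj1Case {t a b} : PRed (.proj1 (.case t a b)) (.case t (.proj1 a) (.proj1 b))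
  | proj2Case {t a b} : PRed (.proj2 (.case t a b)) (.case t (.proj2 a) (.proj2 b))
  | caseCase {t a b c d} : PRed (.case (.case t a b) c d)
      (.case t (.case a (c.rename (liftRen 1 (· + 1))) (d.rename (liftRen 1 (· + 1))))
               (.case b (c.rename (liftRen 1 (· + 1))) (d.rename (liftRen 1 (· + 1)))))
  | boxCase {l₁ l₂ t a b s} :
      PRed (.box (l₁ ++ (.case t a b) :: l₂) s)
        (.case t
          (.box ((l₁.map (Tm.rename (· + 1))) ++ a :: (l₂.map (Tm.rename (· + 1))))
                (s.rename (liftRen (l₁.length + 1 + l₂.length) (· + 1))))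
          (.box ((l₁.map (Tm.rename (· + 1))) ++ b :: (l₂.map (Tm.rename (· + 1))))
                (s.rename (liftRen (l₁.length + 1 + l₂.length) (· + 1)))))

/-- One-step permutation reduction `>_P`: the compatible closure of the root permutations. -/
def StepP : Tm → Tm → Prop := Compat PRed

/-- The union of detour- and permutation-reduction. -/
def StepDP : Tm → Tm → Prop := fun t s => StepD t s ∨ StepP t s

/-- Types of `λ^{□→∧∨}`: atoms, `→`, `×`, `+`, `□`. -/
inductive Ty : Type where
  | atom : ℕ → Ty
  | arr : Ty → Ty → Ty
  | prod : Ty → Ty → Ty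
  | sum : Ty → Ty → Ty
  | box : Ty → Ty

/-- Typing judgment `Γ ⊢ t : A` (contexts are lists, position = de Bruijn index). -/
inductive Typing : List Ty → Tm → Ty → Prop where
  | var {Γ n A} : Γ[n]? = some A → Typing Γ (.var n) A
  | lam {Γ t A B} : Typing (A :: Γ) t B → Typing Γ (.lam t) (.arr A B)
  | app {Γ t s A B} : Typing Γ t (.arr A B) → Typing Γ s A → Typing Γ (.app t s) B
  | pair {Γ t s A B} : Typing Γ t A → Typing Γ s B → Typing Γ (.pair t s) (.prod A B)
  | proj1 {Γ t A B} : Typing Γ t (.prod A B) → Typing Γ (.proj1 t) A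
  | proj2 {Γ t A B} : Typing Γ t (.prod A B) → Typing Γ (.proj2 t) B
  | inl {Γ t A B} : Typing Γ t A → Typing Γ (.inl t) (.sum A B)
  | inr {Γ t A B} : Typing Γ t B → Typing Γ (.inr t) (.sum A B)
  | case {Γ t a b A B C} : Typing Γ t (.sum A B) →
      Typing (A :: Γ) a C → Typing (B :: Γ) b C → Typing Γ (.case t a b) C
  | box {Γ ts s As B} : ts.length = As.length →
      (∀ p ∈ List.zip ts As, Typing Γ p.1 (.box p.2)) →
      Typing (As.reverse ++ Γ) s B →
      Typing Γ (.box ts s) (.box B)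

theorem Tm.ind {P : Tm → Prop} (hvar : ∀ n, P (.var n)) (hlam : ∀ t, P t → P (.lam t))
    (happ : ∀ t s, P t → P s → P (.app t s)) (hpair : ∀ t s, P t → P s → P (.pair t s))
    (hp1 : ∀ t, P t → P (.proj1 t)) (hp2 : ∀ t, P t → P (.proj2 t))
    (hinl : ∀ t, P t → P (.inl t)) (hinr : ∀ t, P t → P (.inr t))
    (hcase : ∀ t a b, P t → P a → P b → P (.case t a b))
    (hbox : ∀ ts s, (∀ t ∈ ts, P t) → P s → P (.box ts s)) : ∀ t, P t
  | .var n => hvar n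
  | .lam t => hlam t (Tm.ind hvar hlam happ hpair hp1 hp2 hinl hinr hcase hbox t)
  | .app t s => happ t s (Tm.ind hvar hlam happ hpair hp1 hp2 hinl hinr hcase hbox t)
      (Tm.ind hvar hlam happ hpair hp1 hp2 hinl hinr hcase hbox s)
  | .pair t s => hpair t s (Tm.ind hvar hlam happ hpair hp1 hp2 hinl hinr hcase hbox t)
      (Tm.ind hvar hlam happ hpair hp1 hp2 hinl hinr hcase hbox s)
  | .proj1 t => hp1 t (Tm.ind hvar hlam happ hpair hp1 hp2 hinl hinr hcase hbox t)
  | .proj2 t => hp2 t (Tm.ind hvar hlam happ hpair hp1 hp2 hinl hinr hcase hbox t)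
  | .inl t => hinl t (Tm.ind hvar hlam happ hpair hp1 hp2 hinl hinr hcase hbox t)
  | .inr t => hinr t (Tm.ind hvar hlam happ hpair hp1 hp2 hinl hinr hcase hbox t)
  | .case t a b => hcase t a b (Tm.ind hvar hlam happ hpair hp1 hp2 hinl hinr hcase hbox t)
      (Tm.ind hvar hlam happ hpair hp1 hp2 hinl hinr hcase hbox a)
      (Tm.ind hvar hlam happ hpair hp1 hp2 hinl hinr hcase hbox b)
  | .box ts s => hbox ts s
      (fun t _ => Tm.ind hvar hlam happ hpair hp1 hp2 hinl hinr hcase hbox t)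
      (Tm.ind hvar hlam happ hpair hp1 hp2 hinl hinr hcase hbox s)
termination_by t => sizeOf t
decreasing_by
  all_goals simp_wf
  all_goals first | omega | (have := List.sizeOf_lt_of_mem ‹_ ∈ _›; omega)

theorem rename_box (f : ℕ → ℕ) (ts : List Tm) (s : Tm) :
    (Tm.box ts s).rename f = .box (ts.map (Tm.rename f)) (s.rename (liftRen ts.length f)) := by
  rw [Tm.rename]; simp

theorem subst_box (σ : ℕ → Tm) (ts : List Tm) (s : Tm) :
    (Tm.box ts s).subst σ = .box (ts.map (Tm.subst σ)) (s.subst (liftSub ts.length σ)) := by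
  rw [Tm.subst]; simp

theorem rename_var (f : ℕ → ℕ) (n : ℕ) : (Tm.var n).rename f = .var (f n) := by rw [Tm.rename]
theorem rename_lam (f : ℕ → ℕ) (t : Tm) :
    (Tm.lam t).rename f = .lam (t.rename (liftRen 1 f)) := by rw [Tm.rename]
theorem rename_app (f : ℕ → ℕ) (t s : Tm) :
    (Tm.app t s).rename f = .app (t.rename f) (s.rename f) := by rw [Tm.rename]
theorem rename_pair (f : ℕ → ℕ) (t s : Tm) :
    (Tm.pair t s).rename f = .pair (t.rename f) (s.rename f) := by rw [Tm.rename]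
theorem rename_proj1 (f : ℕ → ℕ) (t : Tm) :
    (Tm.proj1 t).rename f = .proj1 (t.rename f) := by rw [Tm.rename]
theorem rename_proj2 (f : ℕ → ℕ) (t : Tm) :
    (Tm.proj2 t).rename f = .proj2 (t.rename f) := by rw [Tm.rename]
theorem rename_inl (f : ℕ → ℕ) (t : Tm) :
    (Tm.inl t).rename f = .inl (t.rename f) := by rw [Tm.rename]
theorem rename_inr (f : ℕ → ℕ) (t : Tm) :
    (Tm.inr t).rename f = .inr (t.rename f) := by rw [Tm.rename]
theorem rename_case (f : ℕ → ℕ) (t a b : Tm) : (Tm.case t a b).rename f =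
    .case (t.rename f) (a.rename (liftRen 1 f)) (b.rename (liftRen 1 f)) := by rw [Tm.rename]

theorem subst_vr (f : ℕ → Tm) (n : ℕ) : (Tm.var n).subst f = f n := by rw [Tm.subst]
theorem subst_lam (f : ℕ → Tm) (t : Tm) :
    (Tm.lam t).subst f = .lam (t.subst (liftSub 1 f)) := by rw [Tm.subst]
theorem subst_app (f : ℕ → Tm) (t s : Tm) :
    (Tm.app t s).subst f = .app (t.subst f) (s.subst f) := by rw [Tm.subst]
theorem subst_pair (f : ℕ → Tm) (t s : Tm) :
    (Tm.pair t s).subst f = .pair (t.subst f) (s.subst f) := by rw [Tm.subst]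
theorem subst_proj1 (f : ℕ → Tm) (t : Tm) :
    (Tm.proj1 t).subst f = .proj1 (t.subst f) := by rw [Tm.subst]
theorem subst_proj2 (f : ℕ → Tm) (t : Tm) :
    (Tm.proj2 t).subst f = .proj2 (t.subst f) := by rw [Tm.subst]
theorem subst_inl (f : ℕ → Tm) (t : Tm) :
    (Tm.inl t).subst f = .inl (t.subst f) := by rw [Tm.subst]
theorem subst_inr (f : ℕ → Tm) (t : Tm) :
    (Tm.inr t).subst f = .inr (t.subst f) := by rw [Tm.subst]
theorem subst_case (f : ℕ → Tm) (t a b : Tm) : (Tm.case t a b).subst f =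
    .case (t.subst f) (a.subst (liftSub 1 f)) (b.subst (liftSub 1 f)) := by rw [Tm.subst]

attribute [simp] rename_box rename_var rename_lam rename_app rename_pair rename_proj1 rename_proj2
  rename_inl rename_inr rename_case subst_box subst_vr subst_lam subst_app subst_pair subst_proj1
  subst_proj2 subst_inl subst_inr subst_case

theorem liftRen_comp (n : ℕ) (f g : ℕ → ℕ) (j : ℕ) :
    liftRen n f (liftRen n g j) = liftRen n (fun j => f (g j)) j := by
  unfold liftRen; by_cases h : j < n <;> simp [h]

theorem rename_rename (t : Tm) : ∀ f g : ℕ → ℕ,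
    (t.rename g).rename f = t.rename (fun j => f (g j)) := by
  induction t using Tm.ind <;> intro f g <;> simp_all [liftRen_comp]

theorem liftSub_liftRen (n : ℕ) (σ : ℕ → Tm) (g : ℕ → ℕ) (j : ℕ) :
    liftSub n σ (liftRen n g j) = liftSub n (fun j => σ (g j)) j := by
  unfold liftRen liftSub; by_cases h : j < n <;> simp [h]

theorem subst_rename (t : Tm) : ∀ (σ : ℕ → Tm) (g : ℕ → ℕ),
    (t.rename g).subst σ = t.subst (fun j => σ (g j)) := by
  induction t using Tm.ind <;> intro f g <;> simp_all [liftSub_liftRen]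

theorem liftSub_var (n : ℕ) (f : ℕ → ℕ) :
    liftSub n (fun j => .var (f j)) = fun j => .var (liftRen n f j) := by
  funext j; unfold liftRen liftSub; by_cases h : j < n <;> simp [h]

theorem rename_eq_subst (t : Tm) : ∀ f : ℕ → ℕ, t.rename f = t.subst (fun j => .var (f j)) := by
  induction t using Tm.ind <;> intro f <;> simp_all [liftSub_var]

theorem rename_liftSub (n : ℕ) (σ : ℕ → Tm) (g : ℕ → ℕ) (j : ℕ) :
    (liftSub n σ j).rename (liftRen n g) = liftSub n (fun j => (σ j).rename g) j := by
  unfold liftRen liftSub; by_cases h : j < n <;> simp [h, rename_rename]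

theorem rename_subst (t : Tm) : ∀ (σ : ℕ → Tm) (g : ℕ → ℕ),
    (t.subst σ).rename g = t.subst (fun j => (σ j).rename g) := by
  induction t using Tm.ind <;> intro f g <;> simp_all [rename_liftSub]

theorem subst_liftSub (n : ℕ) (σ τ : ℕ → Tm) (j : ℕ) :
    (liftSub n σ j).subst (liftSub n τ) = liftSub n (fun j => (σ j).subst τ) j := by
  by_cases h : j < n
  · simp [h, liftSub]
  · simp only [liftSub, h, if_false, subst_rename, rename_subst]
    simp

theorem subst_subst (t : Tm) : ∀ (σ τ : ℕ → Tm),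
    (t.subst σ).subst τ = t.subst (fun j => (σ j).subst τ) := by
  induction t using Tm.ind <;> intro f g <;> simp_all [subst_liftSub]

theorem liftSub_id (n : ℕ) : liftSub n Tm.var = Tm.var := by
  funext j; unfold liftSub; by_cases h : j < n
  · simp [h]
  · simp [h]; omega

theorem subst_id (t : Tm) : t.subst Tm.var = t := by
  induction t using Tm.ind <;> simp_all [liftSub_id]
  rename_i ts _ h _
  conv_rhs => rw [← List.map_id ts]
  exact List.map_congr_left (fun t ht => by simpa using h t ht)

theorem rename_id (t : Tm) : t.rename (fun j => j) = t := by
  rw [rename_eq_subst]; exact subst_id t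

/-- Simultaneous substitution: index `0` goes to `s`, the rest is renamed by `f`. -/
def scons (s : Tm) (f : ℕ → ℕ) : ℕ → Tm
  | 0 => s
  | n + 1 => .var (f n)

/-- Root reductions. -/
def Rt (t s : Tm) : Prop := DRed t s ∨ PRed t s

/-- One-step reduction. -/
abbrev Step : Tm → Tm → Prop := Compat Rt

theorem compat_mono {R S : Tm → Tm → Prop} (h : ∀ a b, R a b → S a b) {t s : Tm}
    (hs : Compat R t s) : Compat S t s := by
  induction hs with
  | base h' => exact .base (h _ _ h')
  | lam _ ih => exact .lam ih
  | appL _ ih => exact .appL ih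
  | appR _ ih => exact .appR ih
  | pairL _ ih => exact .pairL ih
  | pairR _ ih => exact .pairR ih
  | proj1 _ ih => exact .proj1 ih
  | proj2 _ ih => exact .proj2 ih
  | inl _ ih => exact .inl ih
  | inr _ ih => exact .inr ih
  | case1 _ ih => exact .case1 ih
  | case2 _ ih => exact .case2 ih
  | case3 _ ih => exact .case3 ih
  | boxArg _ ih => exact .boxArg ih
  | boxBody _ ih => exact .boxBody ih

theorem stepDP_step {t s : Tm} (h : StepDP t s) : Step t s := by
  rcases h with h | h
  · exact compat_mono (fun _ _ => Or.inl) h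
  · exact compat_mono (fun _ _ => Or.inr) h

theorem subst1_eq (t s : Tm) : t.subst1 s = t.subst (scons s (fun j => j)) := by
  unfold Tm.subst1; congr 1

theorem subst1_subst (t s : Tm) (σ : ℕ → Tm) :
    (t.subst1 s).subst σ = (t.subst (liftSub 1 σ)).subst1 (s.subst σ) := by
  simp only [subst1_eq, subst_subst]
  congr 1; funext j
  cases j with
  | zero => simp [scons, liftSub]
  | succ n =>
    have h : ¬ (n + 1 < 1) := by omega
    simp only [scons, liftSub, subst_vr, h, if_false, Nat.add_sub_cancel]
    rw [subst_rename]
    exact (subst_id _).symm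

theorem up_subst (t : Tm) (σ : ℕ → Tm) (k : ℕ) :
    (t.rename (· + k)).subst (liftSub k σ) = (t.subst σ).rename (· + k) := by
  rw [subst_rename, rename_subst]; congr 1; funext j; simp [liftSub]

theorem lup_subst (t : Tm) (σ : ℕ → Tm) (n k : ℕ) :
    (t.rename (liftRen n (· + k))).subst (liftSub n (liftSub k σ)) =
      (t.subst (liftSub n σ)).rename (liftRen n (· + k)) := by
  rw [subst_rename, rename_subst]; congr 1; funext j
  rw [rename_liftSub, liftSub_liftRen]; congr 1; funext j; simp [liftSub]

theorem boxSigma_subst (r v : Tm) (σ : ℕ → Tm) (a m i : ℕ) :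
    (r.subst (boxSigma i m (a + 1 + i) v)).subst (liftSub (a + m + i) σ) =
    (r.subst (liftSub (a + 1 + i) σ)).subst
      (boxSigma i m (a + 1 + i) (v.subst (liftSub m σ))) := by
  rw [subst_subst, subst_subst]; congr 1; funext j
  by_cases h1 : j < i
  · have h2 : j < a + m + i := by omega
    have h3 : j < a + 1 + i := by omega
    simp [boxSigma, liftSub, h1, h2, h3]
  by_cases h2 : j = i
  · subst h2
    have h3 : j < a + 1 + j := by omega
    simp only [boxSigma, liftSub, h3, if_true, lt_irrefl, if_false, subst_vr]
    rw [subst_rename, rename_subst]; congr 1; funext k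
    by_cases hk : k < m
    · have h4 : j + k < a + m + j := by omega
      simp [boxRho, liftSub, hk, h4]
    · have h4 : ¬ (k + (a + 1 + j) - 1 < a + m + j) := by omega
      simp only [boxRho, liftSub, hk, h4, if_false]
      rw [rename_rename]
      have h5 : k + (a + 1 + j) - 1 - (a + m + j) = k - m := by omega
      rw [h5]; congr 1; funext x
      have h6 : ¬ (x + m < m) := by omega
      simp only [boxRho, h6, if_false]; omega
  · by_cases h3 : j < a + 1 + i
    · have h4 : j + m - 1 < a + m + i := by omega
      simp [boxSigma, liftSub, h1, h2, h3, h4]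
    · have h4 : ¬ (j + m - 1 < a + m + i) := by omega
      simp only [boxSigma, liftSub, h1, h2, h3, h4, if_false, subst_vr]
      have h5 : j + m - 1 - (a + m + i) = j - (a + 1 + i) := by omega
      rw [h5, subst_rename, rename_eq_subst]; congr 1; funext x
      have h6 : ¬ (x + (a + 1 + i) < i) := by omega
      have h7 : ¬ (x + (a + 1 + i) = i) := by omega
      simp only [boxSigma, h6, h7, if_false]; congr 1; omega

theorem rt_subst {t s : Tm} (h : Rt t s) (σ : ℕ → Tm) : Rt (t.subst σ) (s.subst σ) := by
  rcases h with h | h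
  · left
    cases h with
    | beta => rw [subst1_subst]; simpa using DRed.beta
    | projPair1 => simpa using DRed.projPair1
    | projPair2 => simpa using DRed.projPair2
    | caseInl => rw [subst1_subst]; simpa using DRed.caseInl
    | caseInr => rw [subst1_subst]; simpa using DRed.caseInr
    | @boxBox l₁ l₂ us v r =>
      have := @DRed.boxBox (l₁.map (Tm.subst σ)) (l₂.map (Tm.subst σ)) (us.map (Tm.subst σ))
        (v.subst (liftSub us.length σ)) (r.subst (liftSub (l₁.length + 1 + l₂.length) σ))
      simp only [List.length_map] at this
      rw [← boxSigma_subst] at this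
      simpa [Nat.add_assoc, Nat.add_comm, Nat.add_left_comm] using this
    | boxVar => simpa [liftSub] using DRed.boxVar
  · right
    cases h with
    | appCase => simpa [up_subst] using PRed.appCase
    | proj1Case => simpa using PRed.proj1Case
    | proj2Case => simpa using PRed.proj2Case
    | caseCase => simpa [lup_subst] using PRed.caseCase
    | @boxCase l₁ l₂ t a b r =>
      have := @PRed.boxCase (l₁.map (Tm.subst σ)) (l₂.map (Tm.subst σ)) (t.subst σ)
        (a.subst (liftSub 1 σ)) (b.subst (liftSub 1 σ))
        (r.subst (liftSub (l₁.length + 1 + l₂.length) σ))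
      simp only [List.length_map, ← lup_subst, List.map_map] at this
      have e : (Tm.rename (· + 1)) ∘ Tm.subst σ = Tm.subst (liftSub 1 σ) ∘ Tm.rename (· + 1) := by
        funext x; simp [up_subst]
      rw [e] at this
      simpa [Nat.add_assoc, Nat.add_comm, Nat.add_left_comm] using this

theorem step_subst {t s : Tm} (h : Step t s) : ∀ σ : ℕ → Tm, Step (t.subst σ) (s.subst σ) := by
  induction h with
  | base h' => exact fun σ => .base (rt_subst h' σ)
  | lam _ ih => intro σ; simpa using .lam (ih _)
  | appL _ ih => intro σ; simpa using .appL (ih _)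
  | appR _ ih => intro σ; simpa using .appR (ih _)
  | pairL _ ih => intro σ; simpa using .pairL (ih _)
  | pairR _ ih => intro σ; simpa using .pairR (ih _)
  | proj1 _ ih => intro σ; simpa using .proj1 (ih _)
  | proj2 _ ih => intro σ; simpa using .proj2 (ih _)
  | inl _ ih => intro σ; simpa using .inl (ih _)
  | inr _ ih => intro σ; simpa using .inr (ih _)
  | case1 _ ih => intro σ; simpa using .case1 (ih _)
  | case2 _ ih => intro σ; simpa using .case2 (ih _)
  | case3 _ ih => intro σ; simpa using .case3 (ih _)
  | boxArg _ ih => intro σ; simpa using .boxArg (ih _)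
  | boxBody _ ih => intro σ; simpa using .boxBody (ih _)

theorem step_rename {t s : Tm} (h : Step t s) (f : ℕ → ℕ) : Step (t.rename f) (s.rename f) := by
  simpa only [rename_eq_subst] using step_subst h _

theorem subst1_rename (t s : Tm) (f : ℕ → ℕ) :
    (t.subst1 s).rename f = (t.rename (liftRen 1 f)).subst1 (s.rename f) := by
  simp only [rename_eq_subst, subst1_subst, liftSub_var]

theorem up_rename (t : Tm) (f : ℕ → ℕ) (k : ℕ) :
    (t.rename (· + k)).rename (liftRen k f) = (t.rename f).rename (· + k) := by
  simp only [rename_rename]; congr 1; funext j; simp [liftRen]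

theorem lup_rename (t : Tm) (f : ℕ → ℕ) (n k : ℕ) :
    (t.rename (liftRen n (· + k))).rename (liftRen n (liftRen k f)) =
      (t.rename (liftRen n f)).rename (liftRen n (· + k)) := by
  simp only [rename_rename, liftRen_comp]; congr 2; funext j; simp [liftRen]

theorem boxSigma_rename (r v : Tm) (f : ℕ → ℕ) (a m i : ℕ) :
    (r.subst (boxSigma i m (a + 1 + i) v)).rename (liftRen (a + m + i) f) =
    (r.rename (liftRen (a + 1 + i) f)).subst
      (boxSigma i m (a + 1 + i) (v.rename (liftRen m f))) := by
  rw [rename_eq_subst _ (liftRen (a + m + i) f), rename_eq_subst _ (liftRen (a + 1 + i) f),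
    rename_eq_subst _ (liftRen m f), ← liftSub_var, ← liftSub_var, ← liftSub_var, boxSigma_subst]

theorem rename_eq_case {t p a b : Tm} {f : ℕ → ℕ} (h : t.rename f = .case p a b) :
    ∃ p' a' b', t = .case p' a' b' ∧ p = p'.rename f ∧ a = a'.rename (liftRen 1 f) ∧
      b = b'.rename (liftRen 1 f) := by
  cases t <;> simp at h
  obtain ⟨rfl, rfl, rfl⟩ := h
  exact ⟨_, _, _, rfl, rfl, rfl, rfl⟩

theorem rename_eq_box {t s : Tm} {ts : List Tm} {f : ℕ → ℕ} (h : t.rename f = .box ts s) :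
    ∃ ts' s', t = .box ts' s' ∧ ts = ts'.map (Tm.rename f) ∧
      s = s'.rename (liftRen ts'.length f) := by
  cases t <;> simp at h
  obtain ⟨rfl, rfl⟩ := h
  exact ⟨_, _, rfl, rfl, rfl⟩

theorem map_eq_mid {α β : Type*} {g : α → β} {l : List α} {l₁ l₂ : List β} {x : β}
    (h : l.map g = l₁ ++ x :: l₂) :
    ∃ k₁ y k₂, l = k₁ ++ y :: k₂ ∧ l₁ = k₁.map g ∧ x = g y ∧ l₂ = k₂.map g := by
  rw [List.map_eq_append_iff] at h
  obtain ⟨k₁, k₂, rfl, rfl, h⟩ := h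
  rw [List.map_eq_cons_iff] at h
  obtain ⟨y, k₃, rfl, rfl, rfl⟩ := h
  exact ⟨_, _, _, rfl, rfl, rfl, rfl⟩

theorem rt_reflect {t s : Tm} {f : ℕ → ℕ} (h : Rt (t.rename f) s) :
    ∃ t', Rt t t' ∧ s = t'.rename f := by
  generalize hy : t.rename f = y at h
  rcases h with h | h
  · cases h with
    | beta =>
      cases t <;> simp at hy
      rename_i t s
      cases t <;> simp at hy
      obtain ⟨rfl, rfl⟩ := hy
      exact ⟨_, .inl .beta, (subst1_rename _ _ _).symm⟩
    | projPair1 =>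
      cases t <;> simp at hy
      rename_i t
      cases t <;> simp at hy
      obtain ⟨rfl, rfl⟩ := hy
      exact ⟨_, .inl .projPair1, rfl⟩
    | projPair2 =>
      cases t <;> simp at hy
      rename_i t
      cases t <;> simp at hy
      obtain ⟨rfl, rfl⟩ := hy
      exact ⟨_, .inl .projPair2, rfl⟩
    | caseInl =>
      cases t <;> simp at hy
      rename_i t _ _
      cases t <;> simp at hy
      obtain ⟨rfl, rfl, rfl⟩ := hy
      exact ⟨_, .inl .caseInl, (subst1_rename _ _ _).symm⟩
    | caseInr =>
      cases t <;> simp at hy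
      rename_i t _ _
      cases t <;> simp at hy
      obtain ⟨rfl, rfl, rfl⟩ := hy
      exact ⟨_, .inl .caseInr, (subst1_rename _ _ _).symm⟩
    | boxBox =>
      obtain ⟨ts, r, rfl, hts, rfl⟩ := rename_eq_box hy
      obtain ⟨k₁, y, k₂, rfl, rfl, hb, rfl⟩ := map_eq_mid hts.symm
      obtain ⟨ws, z, rfl, rfl, rfl⟩ := rename_eq_box hb.symm
      refine ⟨_, .inl .boxBox, ?_⟩
      have := boxSigma_rename r z f k₁.length ws.length k₂.length
      have e3 : k₁.length + (k₂.length + 1) = k₁.length + 1 + k₂.length := by omega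
      simp only [rename_box, List.map_append, List.length_append, List.length_map,
        List.length_cons, e3, this]
    | boxVar =>
      obtain ⟨ts, r, rfl, hts, hr⟩ := rename_eq_box hy
      obtain ⟨y, rfl⟩ : ∃ y, ts = [y] := by
        rw [← List.length_eq_one_iff, ← List.length_map (f := Tm.rename f), ← hts]; rfl
      cases r <;> simp at hr
      rename_i n
      have : n = 0 := by
        unfold liftRen at hr; split_ifs at hr with h <;> omega
      subst this
      simp at hts; subst hts
      exact ⟨_, .inl .boxVar, rfl⟩
  · cases h with
    | appCase =>
      cases t <;> simp at hy
      obtain ⟨hy, rfl⟩ := hy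
      obtain ⟨p, a, b, rfl, rfl, rfl, rfl⟩ := rename_eq_case hy
      exact ⟨_, .inr .appCase, by simp [up_rename]⟩
    | proj1Case =>
      cases t <;> simp at hy
      obtain ⟨p, a, b, rfl, rfl, rfl, rfl⟩ := rename_eq_case hy
      exact ⟨_, .inr .proj1Case, by simp⟩
    | proj2Case =>
      cases t <;> simp at hy
      obtain ⟨p, a, b, rfl, rfl, rfl, rfl⟩ := rename_eq_case hy
      exact ⟨_, .inr .proj2Case, by simp⟩
    | caseCase =>
      obtain ⟨p', a', b', rfl, h, rfl, rfl⟩ := rename_eq_case hy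
      obtain ⟨p, a, b, rfl, rfl, rfl, rfl⟩ := rename_eq_case h.symm
      exact ⟨_, .inr .caseCase, by simp [lup_rename]⟩
    | boxCase =>
      obtain ⟨ts, r, rfl, hts, rfl⟩ := rename_eq_box hy
      obtain ⟨k₁, y, k₂, rfl, rfl, hb, rfl⟩ := map_eq_mid hts.symm
      obtain ⟨p, a, b, rfl, rfl, rfl, rfl⟩ := rename_eq_case hb.symm
      refine ⟨_, .inr .boxCase, ?_⟩
      have e : (Tm.rename (· + 1)) ∘ Tm.rename f =
          Tm.rename (liftRen 1 f) ∘ Tm.rename (· + 1) := by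
        funext x; simp [up_rename]
      have e2 : (k₁ ++ Tm.case p a b :: k₂).length = k₁.length + 1 + k₂.length := by
        simp; omega
      have e3 : k₁.length + (k₂.length + 1) = k₁.length + 1 + k₂.length := by omega
      simp [e, e2, e3, lup_rename]

theorem step_reflect {y s : Tm} (h : Step y s) : ∀ {t : Tm} {f : ℕ → ℕ}, t.rename f = y →
    ∃ t', Step t t' ∧ s = t'.rename f := by
  induction h with
  | base h =>
    rintro t f rfl
    obtain ⟨t', h1, h2⟩ := rt_reflect h
    exact ⟨t', .base h1, h2⟩
  | lam _ ih =>
    intro t f hy; cases t <;> simp at hy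
    obtain ⟨t', h, rfl⟩ := ih hy
    exact ⟨_, .lam h, by simp⟩
  | appL _ ih =>
    intro t f hy; cases t <;> simp at hy
    obtain ⟨t', h, rfl⟩ := ih hy.1
    exact ⟨_, .appL h, by simp [hy]⟩
  | appR _ ih =>
    intro t f hy; cases t <;> simp at hy
    obtain ⟨t', h, rfl⟩ := ih hy.2
    exact ⟨_, .appR h, by simp [hy]⟩
  | pairL _ ih =>
    intro t f hy; cases t <;> simp at hy
    obtain ⟨t', h, rfl⟩ := ih hy.1
    exact ⟨_, .pairL h, by simp [hy]⟩
  | pairR _ ih =>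
    intro t f hy; cases t <;> simp at hy
    obtain ⟨t', h, rfl⟩ := ih hy.2
    exact ⟨_, .pairR h, by simp [hy]⟩
  | proj1 _ ih =>
    intro t f hy; cases t <;> simp at hy
    obtain ⟨t', h, rfl⟩ := ih hy
    exact ⟨_, .proj1 h, by simp⟩
  | proj2 _ ih =>
    intro t f hy; cases t <;> simp at hy
    obtain ⟨t', h, rfl⟩ := ih hy
    exact ⟨_, .proj2 h, by simp⟩
  | inl _ ih =>
    intro t f hy; cases t <;> simp at hy
    obtain ⟨t', h, rfl⟩ := ih hy
    exact ⟨_, .inl h, by simp⟩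
  | inr _ ih =>
    intro t f hy; cases t <;> simp at hy
    obtain ⟨t', h, rfl⟩ := ih hy
    exact ⟨_, .inr h, by simp⟩
  | case1 _ ih =>
    intro t f hy; cases t <;> simp at hy
    obtain ⟨t', h, rfl⟩ := ih hy.1
    exact ⟨_, .case1 h, by simp [hy]⟩
  | case2 _ ih =>
    intro t f hy; cases t <;> simp at hy
    obtain ⟨t', h, rfl⟩ := ih hy.2.1
    exact ⟨_, .case2 h, by simp [hy]⟩
  | case3 _ ih =>
    intro t f hy; cases t <;> simp at hy
    obtain ⟨t', h, rfl⟩ := ih hy.2.2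
    exact ⟨_, .case3 h, by simp [hy]⟩
  | boxArg _ ih =>
    intro t f hy
    obtain ⟨ts, r, rfl, hts, rfl⟩ := rename_eq_box hy
    obtain ⟨k₁, y, k₂, rfl, rfl, hb, rfl⟩ := map_eq_mid hts.symm
    obtain ⟨t', h, rfl⟩ := ih hb.symm
    exact ⟨_, .boxArg h, by simp⟩
  | boxBody _ ih =>
    intro t f hy
    obtain ⟨ts, r, rfl, hts, h⟩ := rename_eq_box hy
    obtain ⟨t', h, rfl⟩ := ih h.symm
    exact ⟨_, .boxBody h, by simp [hts]⟩

/-- Strong normalization. -/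
abbrev SN (t : Tm) : Prop := Acc (fun a b : Tm => Step b a) t

abbrev Pd := Tm → Prop

/-- Candidates. -/
structure Cand (P : Pd) : Prop where
  var : ∀ n, P (.var n)
  ren : ∀ f t, P t → P (t.rename f)
  step : ∀ t t', P t → Step t t' → P t'
  sn : ∀ t, P t → SN t

def sumV (P Q : Pd) : Pd
  | .inl w => P w
  | .inr w => Q w
  | _ => False

def boxV (P : Pd) : Pd
  | .box [] w => P w
  | _ => False

/-- `v`, with its bound variables instantiated according to `L`, lies in `P`. -/
def Body (L : List (Pd × Tm)) (v : Tm) (P : Pd) : Prop :=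
  ∀ (σ : ℕ → Tm) (f : ℕ → ℕ), (∀ (j : ℕ) (e : Pd × Tm), L.reverse[j]? = some e → e.1 (σ j)) →
    (∀ j, σ (j + L.length) = .var (f j)) → P (v.subst σ)

/-- Shape condition. -/
def Sh (X : Pd → Tm → Prop) (V : Pd) : Tm → Prop
  | .lam u => V (.lam u)
  | .pair a b => V (.pair a b)
  | .inl a => V (.inl a)
  | .inr a => V (.inr a)
  | .case p a b => ∃ P Q, Cand P ∧ Cand Q ∧ X (sumV P Q) p ∧
      (∀ f w, P w → X V (a.subst (scons w f))) ∧ (∀ f w, Q w → X V (b.subst (scons w f)))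
  | .box us v => ∃ L : List (Pd × Tm), L.map Prod.snd = us ∧
      (∀ e ∈ L, Cand e.1 ∧ X (boxV e.1) e.2) ∧ Body L v (fun w => V (.box [] w))
  | _ => True

def MF (X : Pd → Tm → Prop) (V : Pd) (t : Tm) : Prop :=
  (∀ t', Step t t' → X V t') ∧ Sh X V t

/-- Reducible terms over a set `V` of values (least fixed point of `MF`). -/
def M (V : Pd) (t : Tm) : Prop :=
  ∀ X : Pd → Tm → Prop, (∀ V t, MF X V t → X V t) → X V t

theorem MF_mono {X Y : Pd → Tm → Prop} (h : ∀ V t, X V t → Y V t) {V : Pd} {t : Tm}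
    (hm : MF X V t) : MF Y V t := by
  refine ⟨fun t' ht => h _ _ (hm.1 t' ht), ?_⟩
  have h2 := hm.2
  cases t with
  | case p a b =>
    obtain ⟨P, Q, h1, h2, h3, h4, h5⟩ := h2
    exact ⟨P, Q, h1, h2, h _ _ h3, fun f w hw => h _ _ (h4 f w hw), fun f w hw => h _ _ (h5 f w hw)⟩
  | box us v =>
    obtain ⟨L, h1, h2, h3⟩ := h2
    exact ⟨L, h1, fun e he => ⟨(h2 e he).1, h _ _ (h2 e he).2⟩, h3⟩
  | _ => exact h2

theorem M_fold {V : Pd} {t : Tm} (h : MF M V t) : M V t :=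
  fun X hX => hX _ _ (MF_mono (fun _ _ hm => hm X hX) h)

theorem M_unfold {V : Pd} {t : Tm} (h : M V t) : MF M V t :=
  h (fun V t => MF M V t) (fun _ _ hm => MF_mono (fun _ _ => M_fold) hm)

theorem M_ind {X : Pd → Tm → Prop}
    (hX : ∀ V t, MF (fun V t => M V t ∧ X V t) V t → X V t) {V : Pd} {t : Tm} (h : M V t) :
    X V t :=
  (h (fun V t => M V t ∧ X V t) (fun _ _ hm =>
    ⟨M_fold (MF_mono (fun _ _ => And.left) hm), hX _ _ hm⟩)).2

theorem M_step {V : Pd} {t t' : Tm} (h : M V t) (hs : Step t t') : M V t' := (M_unfold h).1 _ hs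

theorem M_sn {V : Pd} {t : Tm} (h : M V t) : SN t :=
  M_ind (X := fun _ t => SN t) (fun _ t hm => Acc.intro t (fun t' ht => (hm.1 t' ht).2)) h

theorem M_var (V : Pd) (n : ℕ) : M V (.var n) := by
  refine M_fold ⟨fun t' ht => ?_, trivial⟩
  cases ht with
  | base h => rcases h with h | h <;> cases h

/-- Renaming in annotated argument lists. -/
def LR (f : ℕ → ℕ) (L : List (Pd × Tm)) : List (Pd × Tm) := L.map (fun e => (e.1, e.2.rename f))

theorem LR_append (f : ℕ → ℕ) (A B : List (Pd × Tm)) : LR f (A ++ B) = LR f A ++ LR f B := by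
  simp [LR]

theorem LR_LR (f g : ℕ → ℕ) (A : List (Pd × Tm)) : LR f (LR g A) = LR (fun j => f (g j)) A := by
  simp [LR, rename_rename]

theorem LR_id (A : List (Pd × Tm)) : LR (fun j => j) A = A := by
  simp [LR, rename_id]

theorem LR_length (f : ℕ → ℕ) (A : List (Pd × Tm)) : (LR f A).length = A.length := by
  simp [LR]

theorem LR_snd (f : ℕ → ℕ) (A : List (Pd × Tm)) :
    (LR f A).map Prod.snd = (A.map Prod.snd).map (Tm.rename f) := by
  simp [LR]

theorem Body_rename {L : List (Pd × Tm)} {v : Tm} {P : Pd} (h : Body L v P) {K : List (Pd × Tm)}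
    (hK : K.map Prod.fst = L.map Prod.fst) (f : ℕ → ℕ) :
    Body K (v.rename (liftRen L.length f)) P := by
  have hlen : K.length = L.length := by simpa using congrArg List.length hK
  intro σ g h1 h2
  rw [subst_rename]
  refine h _ (fun j => g (f j)) ?_ ?_
  · intro j e he
    have hj : j < L.length := by
      have := (List.getElem?_eq_some_iff.1 he).1
      simpa using this
    have hK' : (K.reverse.map Prod.fst)[j]? = some e.1 := by
      rw [List.map_reverse, hK, ← List.map_reverse, List.getElem?_map, he]; rfl
    rw [List.getElem?_map, Option.map_eq_some_iff] at hK'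
    obtain ⟨e', he', hee⟩ := hK'
    rw [← hee]
    simpa [liftRen, hj] using h1 j e' he'
  · intro j
    have : ¬ (j + L.length < L.length) := by omega
    simp only [liftRen, this, if_false, Nat.add_sub_cancel]
    rw [← h2, hlen]

theorem Body_box {L₁ L₂ W : List (Pd × Tm)} {P Pr : Pd} {u r z : Tm}
    (h : Body (L₁ ++ (P, u) :: L₂) r Pr) (hz : Body W z P) :
    Body (L₁ ++ W ++ L₂)
      (r.subst (boxSigma L₂.length W.length (L₁.length + 1 + L₂.length) z)) Pr := by
  intro σ f h1 h2
  rw [subst_subst]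
  refine h _ f ?_ ?_
  · intro j e he
    simp only [List.reverse_append, List.reverse_cons, List.append_assoc] at he h1
    by_cases c1 : j < L₂.length
    · rw [List.getElem?_append_left (by simpa using c1)] at he
      have := h1 j e (by rw [List.getElem?_append_left (by simpa using c1)]; exact he)
      simpa [boxSigma, c1] using this
    rw [List.getElem?_append_right (by simpa using c1)] at he
    by_cases c2 : j = L₂.length
    · subst c2
      simp at he
      subst he
      simp only [boxSigma, lt_irrefl, if_false, if_true]
      rw [subst_rename]
      refine hz _ f ?_ ?_
      · intro k e he
        have hk : k < W.length := by
          have := (List.getElem?_eq_some_iff.1 he).1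
          simpa using this
        simp only [boxRho, hk, if_true]
        refine h1 _ e ?_
        rw [List.getElem?_append_right (by simp), List.getElem?_append_left (by simpa using hk)]
        simpa using he
      · intro k
        have hk : ¬ (k + W.length < W.length) := by omega
        simp only [boxRho, hk, if_false]
        rw [← h2]; congr 1; simp; omega
    · obtain ⟨k, rfl⟩ : ∃ k, j = L₂.length + 1 + k := ⟨j - (L₂.length + 1), by omega⟩
      have e1 : L₂.length + 1 + k - L₂.length = k + 1 := by omega
      have e2 : L₂.length + 1 + k + W.length - 1 = L₂.length + (W.length + k) := by omega
      simp only [boxSigma, c1, c2, if_false, subst_vr, e2]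
      refine h1 _ e ?_
      rw [List.getElem?_append_right (by simp), List.getElem?_append_right (by simp)]
      simpa [e1] using he
  · intro j
    have c1 : ¬ (j + (L₁ ++ (P, u) :: L₂).length < L₂.length) := by simp; omega
    have c2 : ¬ (j + (L₁ ++ (P, u) :: L₂).length = L₂.length) := by simp; omega
    simp only [boxSigma, c1, c2, if_false, subst_vr]
    rw [← h2]; congr 1; simp; omega

theorem M_rename {V : Pd} {t : Tm} (h : M V t) :
    (∀ f t, V t → V (t.rename f)) → ∀ f, M V (t.rename f) := by
  refine M_ind (X := fun V t => (∀ f t, V t → V (t.rename f)) → ∀ f, M V (t.rename f)) ?_ h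
  clear h
  intro V t hm hV f
  refine M_fold ⟨fun s hs => ?_, ?_⟩
  · obtain ⟨t', ht, rfl⟩ := step_reflect hs rfl
    exact (hm.1 _ ht).2 hV f
  have h2 := hm.2
  cases t with
  | var n => simp [Sh]
  | app _ _ => simp [Sh]
  | proj1 _ => simp [Sh]
  | proj2 _ => simp [Sh]
  | lam _ => have := hV f _ h2; simpa [Sh] using this
  | pair _ _ => have := hV f _ h2; simpa [Sh] using this
  | inl _ => have := hV f _ h2; simpa [Sh] using this
  | inr _ => have := hV f _ h2; simpa [Sh] using this
  | case p a b =>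
    obtain ⟨P, Q, hP, hQ, h3, h4, h5⟩ := h2
    have key : ∀ (c : Tm) w g, (c.rename (liftRen 1 f)).subst (scons w g) =
        c.subst (scons w (fun j => g (f j))) := by
      intro c w g
      rw [subst_rename]; congr 1; funext j; cases j <;> simp [liftRen, scons]
    simp only [rename_case, Sh, key]
    refine ⟨P, Q, hP, hQ, h3.2 ?_ f, fun g w hw => (h4 _ w hw).1, fun g w hw => (h5 _ w hw).1⟩
    intro f t ht
    cases t <;> simp [sumV] at ht ⊢
    · exact hP.ren _ _ ht
    · exact hQ.ren _ _ ht
  | box us v =>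
    obtain ⟨L, rfl, h3, h4⟩ := h2
    simp only [rename_box, Sh]
    refine ⟨LR f L, LR_snd f L, ?_, ?_⟩
    · intro e he
      simp only [LR, List.mem_map] at he
      obtain ⟨e', he', rfl⟩ := he
      refine ⟨(h3 e' he').1, (h3 e' he').2.2 ?_ f⟩
      intro f t ht
      cases t <;> simp only [boxV] at ht ⊢
      rename_i ts s
      cases ts <;> simp [boxV] at ht ⊢
      have := (h3 e' he').1.ren (liftRen 0 f) _ ht
      exact this
    · rw [List.length_map]
      exact Body_rename h4 (by simp [LR, Function.comp_def]) f

theorem M_cand {V : Pd} (hV : ∀ f t, V t → V (t.rename f)) : Cand (M V) :=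
  ⟨M_var V, fun f _ h => M_rename h hV f, fun _ _ h hs => M_step h hs, fun _ h => M_sn h⟩

theorem ren_scons (c w : Tm) (f g : ℕ → ℕ) : (c.rename (liftRen 1 f)).subst (scons w g) =
    c.subst (scons w (fun j => g (f j))) := by
  rw [subst_rename]; congr 1; funext j; cases j <;> simp [liftRen, scons]

theorem up_scons (t w : Tm) (f : ℕ → ℕ) : (t.rename (· + 1)).subst (scons w f) = t.rename f := by
  rw [subst_rename, rename_eq_subst]; rfl

theorem lup_scons (t w : Tm) (n : ℕ) (f : ℕ → ℕ) :
    (t.rename (liftRen n (· + 1))).subst (liftSub n (scons w f)) = t.rename (liftRen n f) := by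
  rw [subst_rename, rename_eq_subst, ← liftSub_var]; congr 1; funext j
  rw [liftSub_liftRen]; rfl

theorem scons_id (t : Tm) : t.subst (scons (.var 0) (· + 1)) = t := by
  have : scons (.var 0) (· + 1) = Tm.var := by funext j; cases j <;> rfl
  rw [this, subst_id]

theorem M_case {V P Q : Pd} {p c d : Tm} (hp : M (sumV P Q) p) (hP : Cand P) (hQ : Cand Q)
    (hc : ∀ f w, P w → M V (c.subst (scons w f))) (hd : ∀ f w, Q w → M V (d.subst (scons w f))) :
    M V (.case p c d) := by
  refine M_ind (X := fun W p => ∀ P Q, W = sumV P Q → Cand P → Cand Q → ∀ c d,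
    (∀ f w, P w → M V (c.subst (scons w f))) → (∀ f w, Q w → M V (d.subst (scons w f))) →
    M V (.case p c d)) ?_ hp P Q rfl hP hQ c d hc hd
  clear hp hP hQ hc hd p c d P Q
  intro W p hm P Q hW hP hQ c d hc
  subst hW
  have hM : M (sumV P Q) p := M_fold (MF_mono (fun _ _ => And.left) hm)
  have sc : SN c := by
    have := hc (· + 1) _ (hP.var 0); rw [scons_id] at this; exact M_sn this
  induction sc generalizing d with
  | intro c _ ihc =>
  intro hd
  have sd : SN d := by
    have := hd (· + 1) _ (hQ.var 0); rw [scons_id] at this; exact M_sn this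
  induction sd with
  | intro d _ ihd =>
  refine M_fold ⟨?_, P, Q, hP, hQ, hM, hc, hd⟩
  intro t' ht
  cases ht with
  | base h =>
    rcases h with h | h
    · cases h with
      | caseInl => rw [subst1_eq]; exact hc _ _ hm.2
      | caseInr => rw [subst1_eq]; exact hd _ _ hm.2
    · cases h with
      | caseCase =>
        obtain ⟨P', Q', hP', hQ', h1, h2, h3⟩ := hm.2
        refine h1.2 P' Q' rfl hP' hQ' _ _ ?_ ?_
        · intro f w hw
          simp only [subst_case, lup_scons]
          refine (h2 f w hw).2 P Q rfl hP hQ _ _ ?_ ?_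
          · intro g w hw; rw [ren_scons]; exact hc _ _ hw
          · intro g w hw; rw [ren_scons]; exact hd _ _ hw
        · intro f w hw
          simp only [subst_case, lup_scons]
          refine (h3 f w hw).2 P Q rfl hP hQ _ _ ?_ ?_
          · intro g w hw; rw [ren_scons]; exact hc _ _ hw
          · intro g w hw; rw [ren_scons]; exact hd _ _ hw
  | case1 h => exact (hm.1 _ h).2 P Q rfl hP hQ c d hc hd
  | case2 h => exact ihc _ h d (fun f w hw => M_step (hc f w hw) (step_subst h _)) hd
  | case3 h => exact ihd _ h (fun f w hw => M_step (hd f w hw) (step_subst h _))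

/-- One unfolding of goodness of an annotated argument list. -/
def MLF (X : List (Pd × Tm) → Prop) (L : List (Pd × Tm)) : Prop :=
  ∀ f, (∀ e ∈ LR f L, Cand e.1 ∧ M (boxV e.1) e.2) ∧
    (∀ L₁ P u u' L₂, LR f L = L₁ ++ (P, u) :: L₂ → Step u u' → X (L₁ ++ (P, u') :: L₂)) ∧
    (∀ L₁ P ws z L₂, LR f L = L₁ ++ (P, .box ws z) :: L₂ →
      ∃ W : List (Pd × Tm), W.map Prod.snd = ws ∧ Body W z P ∧ X (L₁ ++ W ++ L₂)) ∧
    (∀ L₁ P p a b L₂, LR f L = L₁ ++ (P, .case p a b) :: L₂ →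
      ∃ A B, Cand A ∧ Cand B ∧ M (sumV A B) p ∧
        (∀ g w, A w → X (LR g L₁ ++ (P, a.subst (scons w g)) :: LR g L₂)) ∧
        (∀ g w, B w → X (LR g L₁ ++ (P, b.subst (scons w g)) :: LR g L₂)))

def ML (L : List (Pd × Tm)) : Prop := ∀ X : List (Pd × Tm) → Prop, (∀ L, MLF X L → X L) → X L

theorem MLF_mono {X Y : List (Pd × Tm) → Prop} (h : ∀ L, X L → Y L) {L : List (Pd × Tm)}
    (hm : MLF X L) : MLF Y L := by
  intro f
  obtain ⟨h1, h2, h3, h4⟩ := hm f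
  refine ⟨h1, ?_, ?_, ?_⟩
  · intro L₁ P u u' L₂ e hs; exact h _ (h2 L₁ P u u' L₂ e hs)
  · intro L₁ P ws z L₂ e
    obtain ⟨W, a, b, c⟩ := h3 L₁ P ws z L₂ e
    exact ⟨W, a, b, h _ c⟩
  · intro L₁ P p a b L₂ e
    obtain ⟨A, B, hA, hB, hp, ha, hb⟩ := h4 L₁ P p a b L₂ e
    exact ⟨A, B, hA, hB, hp, fun g w hw => h _ (ha g w hw), fun g w hw => h _ (hb g w hw)⟩

theorem ML_fold {L : List (Pd × Tm)} (h : MLF ML L) : ML L :=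
  fun X hX => hX _ (MLF_mono (fun _ hm => hm X hX) h)

theorem ML_unfold {L : List (Pd × Tm)} (h : ML L) : MLF ML L :=
  h (fun L => MLF ML L) (fun _ hm => MLF_mono (fun _ => ML_fold) hm)

theorem ML_ind {X : List (Pd × Tm) → Prop} (hX : ∀ L, MLF (fun L => ML L ∧ X L) L → X L)
    {L : List (Pd × Tm)} (h : ML L) : X L :=
  (h (fun L => ML L ∧ X L) (fun _ hm =>
    ⟨ML_fold (MLF_mono (fun _ => And.left) hm), hX _ hm⟩)).2

theorem ML_rename {L : List (Pd × Tm)} (h : ML L) (f : ℕ → ℕ) : ML (LR f L) := by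
  refine ML_fold fun g => ?_
  rw [LR_LR]
  exact ML_unfold h _

theorem split_mid {α : Type*} {A B K₁ K₂ : List α} {x : α} (h : A ++ B = K₁ ++ x :: K₂) :
    (∃ C, A = K₁ ++ x :: C ∧ K₂ = C ++ B) ∨ (∃ C, B = C ++ x :: K₂ ∧ K₁ = A ++ C) := by
  rw [List.append_eq_append_iff] at h
  rcases h with ⟨C, h1, h2⟩ | ⟨C, h1, h2⟩
  · exact Or.inr ⟨C, h2, h1⟩
  · cases C with
    | nil =>
      simp at h1 h2
      exact Or.inr ⟨[], by simp [h2], by simp [h1]⟩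
    | cons y C =>
      simp at h2
      obtain ⟨rfl, rfl⟩ := h2
      exact Or.inl ⟨C, h1, rfl⟩

theorem ML_append {A : List (Pd × Tm)} (hA : ML A) : ∀ {B : List (Pd × Tm)}, ML B →
    ∀ g, ML (LR g A ++ B) := by
  refine ML_ind (X := fun A => ∀ {B : List (Pd × Tm)}, ML B → ∀ g, ML (LR g A ++ B)) ?_ hA
  clear hA A
  intro A hA B hB
  refine ML_ind (X := fun B => ∀ g, ML (LR g A ++ B)) ?_ hB
  clear hB B
  intro B hB' g
  refine ML_fold fun h => ?_
  have hB : ML B := ML_fold (MLF_mono (fun _ => And.left) hB')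
  have eA : ∀ A f, LR f A = LR f A ++ [] := by simp
  rw [LR_append, LR_LR]
  obtain ⟨a1, a2, a3, a4⟩ := hA (fun j => h (g j))
  obtain ⟨b1, b2, b3, b4⟩ := hB' h
  refine ⟨?_, ?_, ?_, ?_⟩
  · intro e he
    rcases List.mem_append.1 he with he | he
    · exact a1 e he
    · exact b1 e he
  · intro L₁ P u u' L₂ e hs
    rcases split_mid e with ⟨C, e', rfl⟩ | ⟨C, e', rfl⟩
    · have := (a2 _ _ _ _ _ e' hs).2 (ML_rename hB h) (fun j => j)
      simpa [LR_id] using this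
    · have := (b2 _ _ _ _ _ e' hs).2 (fun j => h (g j))
      simpa using this
  · intro L₁ P ws z L₂ e
    rcases split_mid e with ⟨C, e', rfl⟩ | ⟨C, e', rfl⟩
    · obtain ⟨W, w1, w2, w3⟩ := a3 _ _ _ _ _ e'
      have := w3.2 (ML_rename hB h) (fun j => j)
      exact ⟨W, w1, w2, by simpa [LR_id] using this⟩
    · obtain ⟨W, w1, w2, w3⟩ := b3 _ _ _ _ _ e'
      have := w3.2 (fun j => h (g j))
      exact ⟨W, w1, w2, by simpa using this⟩
  · intro L₁ P p a b L₂ e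
    rcases split_mid e with ⟨C, e', rfl⟩ | ⟨C, e', rfl⟩
    · obtain ⟨U, W, hU, hW, hp, w1, w2⟩ := a4 _ _ _ _ _ _ e'
      refine ⟨U, W, hU, hW, hp, fun k w hw => ?_, fun k w hw => ?_⟩
      · have := (w1 k w hw).2 (ML_rename (ML_rename hB h) k) (fun j => j)
        simpa [LR_id, LR_append] using this
      · have := (w2 k w hw).2 (ML_rename (ML_rename hB h) k) (fun j => j)
        simpa [LR_id, LR_append] using this
    · obtain ⟨U, W, hU, hW, hp, w1, w2⟩ := b4 _ _ _ _ _ _ e'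
      refine ⟨U, W, hU, hW, hp, fun k w hw => ?_, fun k w hw => ?_⟩
      · have := (w1 k w hw).2 (fun j => k (h (g j)))
        simpa [LR_LR, LR_append] using this
      · have := (w2 k w hw).2 (fun j => k (h (g j)))
        simpa [LR_LR, LR_append] using this

theorem ML_nil : ML [] := by
  refine ML_fold fun f => ⟨?_, ?_, ?_, ?_⟩ <;> simp [LR]

theorem ML_of_singles {L : List (Pd × Tm)} (h : ∀ e ∈ L, ML [e]) : ML L := by
  induction L with
  | nil => exact ML_nil
  | cons e L ih =>
    have := ML_append (h e (by simp)) (ih fun e he => h e (by simp [he])) (fun j => j)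
    simpa [LR_id] using this

theorem boxV_ren {P : Pd} (hP : Cand P) : ∀ f t, boxV P t → boxV P (t.rename f) := by
  intro f t ht
  cases t <;> simp only [boxV] at ht ⊢
  rename_i ts s
  cases ts <;> simp [boxV] at ht ⊢
  exact hP.ren (liftRen 0 f) _ ht

theorem single_eq {α : Type*} {x y : α} {A B : List α} (h : [x] = A ++ y :: B) :
    A = [] ∧ y = x ∧ B = [] := by
  cases A <;> simp_all

theorem ML_single {P : Pd} {t : Tm} (hP : Cand P) (h : M (boxV P) t) : ML [(P, t)] := by
  refine M_ind (X := fun V t => ∀ P, V = boxV P → Cand P → ML [(P, t)]) ?_ h P rfl hP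
  clear h hP P t
  intro V t hm P hV hP
  subst hV
  have hM : M (boxV P) t := M_fold (MF_mono (fun _ _ => And.left) hm)
  refine ML_fold fun f => ?_
  have e0 : LR f [(P, t)] = [(P, t.rename f)] := rfl
  rw [e0]
  refine ⟨?_, ?_, ?_, ?_⟩
  · intro e he
    simp at he; subst he
    exact ⟨hP, M_rename hM (boxV_ren hP) f⟩
  · intro L₁ P' u u' L₂ e hs
    obtain ⟨rfl, e', rfl⟩ := single_eq e
    cases e'
    obtain ⟨t', ht, rfl⟩ := step_reflect hs rfl
    exact ML_rename ((hm.1 _ ht).2 P rfl hP) f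
  · intro L₁ P' ws z L₂ e
    obtain ⟨rfl, e', rfl⟩ := single_eq e
    simp only [Prod.mk.injEq] at e'
    obtain ⟨rfl, e'⟩ := e'
    obtain ⟨ws, z, rfl, rfl, rfl⟩ := rename_eq_box e'.symm
    obtain ⟨L, rfl, h1, h2⟩ := hm.2
    refine ⟨LR f L, LR_snd f L, ?_, ?_⟩
    · rw [List.length_map]
      exact Body_rename h2 (by simp [LR, Function.comp_def]) f
    · have : ML L := ML_of_singles fun e he => (h1 e he).2.2 e.1 rfl (h1 e he).1
      simpa using ML_rename this f
  · intro L₁ P' p a b L₂ e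
    obtain ⟨rfl, e', rfl⟩ := single_eq e
    simp only [Prod.mk.injEq] at e'
    obtain ⟨rfl, e'⟩ := e'
    obtain ⟨p, a, b, rfl, rfl, rfl, rfl⟩ := rename_eq_case e'.symm
    obtain ⟨U, W, hU, hW, h1, h2, h3⟩ := hm.2
    refine ⟨U, W, hU, hW, M_rename h1.1 ?_ f, fun g w hw => ?_, fun g w hw => ?_⟩
    · intro f t ht
      cases t <;> simp [sumV] at ht ⊢
      · exact hU.ren _ _ ht
      · exact hW.ren _ _ ht
    · rw [ren_scons]; exact (h2 _ w hw).2 P' rfl hP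
    · rw [ren_scons]; exact (h3 _ w hw).2 P' rfl hP

theorem M_mono {P Q : Pd} (hPQ : ∀ t, P t → Q t) {t : Tm} (h : M (boxV P) t) : M (boxV Q) t := by
  have hV : ∀ t, boxV P t → boxV Q t := by
    intro t ht
    cases t <;> simp only [boxV] at ht ⊢
    rename_i ts s
    cases ts <;> simp [boxV] at ht ⊢
    exact hPQ _ ht
  refine M_ind (X := fun V t => V = boxV P → M (boxV Q) t) ?_ h rfl
  clear h
  intro V t hm e
  subst e
  refine M_fold ⟨fun t' ht => (hm.1 _ ht).2 rfl, ?_⟩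
  have h2 := hm.2
  cases t with
  | case p a b =>
    obtain ⟨P, Q, h1, h2, h3, h4, h5⟩ := h2
    exact ⟨P, Q, h1, h2, h3.1, fun f w hw => (h4 f w hw).2 rfl, fun f w hw => (h5 f w hw).2 rfl⟩
  | box us v =>
    obtain ⟨L, h1, h2, h3⟩ := h2
    exact ⟨L, h1, fun e he => ⟨(h2 e he).1, (h2 e he).2.1⟩,
      fun σ f a b => hV _ (h3 σ f a b)⟩
  | lam u => exact hV (.lam u) h2
  | pair u v => exact hV (.pair u v) h2
  | inl u => exact hV (.inl u) h2
  | inr u => exact hV (.inr u) h2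
  | _ => trivial

theorem M_box' {P : Pd} (hP : Cand P) {L : List (Pd × Tm)} (hL : ML L) :
    ∀ v, Body L v P → M (boxV P) (.box (L.map Prod.snd) v) := by
  refine ML_ind (X := fun L => ∀ v, Body L v P → M (boxV P) (.box (L.map Prod.snd) v)) ?_ hL
  clear hL L
  intro L hL v hv
  obtain ⟨h1, h2, h3, h4⟩ := hL (fun j => j)
  rw [LR_id] at h1 h2 h3 h4
  have sv : SN v := by
    have := hv Tm.var (· + L.length) ?_ (fun j => rfl)
    · rw [subst_id] at this; exact hP.sn _ this
    · intro j e he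
      have : e ∈ L.reverse := List.mem_of_getElem? he
      exact (h1 e (by simpa using this)).1.var j
  induction sv with
  | intro v _ ihv =>
  refine M_fold ⟨?_, L, rfl, h1, hv⟩
  intro t' ht
  generalize hus : L.map Prod.snd = us at ht
  cases ht with
  | base h =>
    rcases h with h | h
    · cases h with
      | boxBox =>
        obtain ⟨K₁, ⟨R, y⟩, K₂, rfl, rfl, hy, rfl⟩ := map_eq_mid hus
        simp only at hy; subst hy
        obtain ⟨W, rfl, hW, hX⟩ := h3 _ _ _ _ _ rfl
        have := hX.2 _ (Body_box hv hW)
        simpa using this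
      | boxVar =>
        obtain ⟨K₁, ⟨R, y⟩, K₂, rfl, hK₁, hy, hK₂⟩ := map_eq_mid (l₁ := []) hus
        simp at hK₁ hK₂ hy
        subst hK₁ hK₂ hy
        refine M_mono ?_ (h1 (R, _) (by simp)).2
        intro t ht
        have hq : P ((Tm.var 0).subst (scons t (fun j => j))) := by
          refine hv (scons t (fun j => j)) (fun j => j) ?_ (fun j => rfl)
          intro j e he
          cases j <;> simp at he
          subst he; exact ht
        simpa [Tm.subst, scons] using hq
    · cases h with
      | boxCase =>
        obtain ⟨K₁, ⟨R, y⟩, K₂, rfl, rfl, hy, rfl⟩ := map_eq_mid hus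
        simp only at hy; subst hy
        obtain ⟨A, B, hA, hB, hp, ha, hb⟩ := h4 _ _ _ _ _ _ rfl
        have key : ∀ (c w : Tm) (f : ℕ → ℕ),
            (Tm.box ((List.map Prod.snd K₁).map (Tm.rename (· + 1)) ++ c ::
              (List.map Prod.snd K₂).map (Tm.rename (· + 1)))
              (v.rename (liftRen ((List.map Prod.snd K₁).length + 1 +
                (List.map Prod.snd K₂).length) (· + 1)))).subst (scons w f) =
            Tm.box ((LR f K₁ ++ (R, c.subst (scons w f)) :: LR f K₂).map Prod.snd)
              (v.rename (liftRen (K₁.length + 1 + K₂.length) f)) := by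
          intro c w f
          have e3 : K₁.length + (K₂.length + 1) = K₁.length + 1 + K₂.length := by omega
          simp [e3, lup_scons, LR, Function.comp_def, up_scons]
        have e3 : ∀ c : Tm, (K₁ ++ (R, c) :: K₂).length = K₁.length + 1 + K₂.length := by
          intro c; simp; omega
        refine M_case hp hA hB (fun f w hw => ?_) (fun f w hw => ?_)
        · rw [key]
          refine (ha f w hw).2 _ ?_
          rw [← e3]
          exact Body_rename hv (by simp [LR, Function.comp_def]) f
        · rw [key]
          refine (hb f w hw).2 _ ?_
          rw [← e3]
          exact Body_rename hv (by simp [LR, Function.comp_def]) f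
  | boxArg h =>
    obtain ⟨K₁, ⟨R, y⟩, K₂, rfl, rfl, hy, rfl⟩ := map_eq_mid hus
    simp only at hy; subst hy
    rename_i t₀ t₁
    have := (h2 _ _ _ _ _ rfl h).2 v ?_
    · simpa using this
    · have := Body_rename hv (K := K₁ ++ (R, t₁) :: K₂) (by simp) (fun j => j)
      have e : ∀ n, liftRen n (fun j => j) = fun j => j := by
        intro n; funext j; show (if j < n then j else (j - n) + n) = j; split_ifs <;> omega
      rw [e, rename_id] at this
      exact this
  | boxBody h =>
    subst hus
    exact ihv _ h (fun σ f a b => hP.step _ _ (hv σ f a b) (step_subst h _))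

theorem M_box {P : Pd} (hP : Cand P) {L : List (Pd × Tm)}
    (hL : ∀ e ∈ L, Cand e.1 ∧ M (boxV e.1) e.2) {v : Tm} (hv : Body L v P) :
    M (boxV P) (.box (L.map Prod.snd) v) :=
  M_box' hP (ML_of_singles fun e he => ML_single (hL e he).1 (hL e he).2) v hv

def val : Ty → Pd
  | .atom _ => fun _ => False
  | .arr A B => fun t => ∃ u, t = .lam u ∧
      ∀ f s, M (val A) s → M (val B) (u.subst (scons s f))
  | .prod A B => fun t => ∃ a b, t = .pair a b ∧ M (val A) a ∧ M (val B) b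
  | .sum A B => sumV (M (val A)) (M (val B))
  | .box A => boxV (M (val A))

theorem val_ren (A : Ty) : ∀ f t, val A t → val A (t.rename f) := by
  induction A with
  | atom _ => exact fun _ _ h => h
  | arr A B ihA ihB =>
    rintro f t ⟨u, rfl, h⟩
    refine ⟨_, rename_lam _ _, fun g s hs => ?_⟩
    rw [ren_scons]; exact h _ _ hs
  | prod A B ihA ihB =>
    rintro f t ⟨a, b, rfl, h1, h2⟩
    exact ⟨_, _, rename_pair _ _ _, M_rename h1 ihA f, M_rename h2 ihB f⟩
  | sum A B ihA ihB =>
    intro f t ht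
    cases t <;> simp [val, sumV] at ht ⊢
    · exact M_rename ht ihA f
    · exact M_rename ht ihB f
  | box A ih => exact boxV_ren (M_cand ih)

theorem val_cand (A : Ty) : Cand (M (val A)) := M_cand (val_ren A)

theorem M_lam {A B : Ty} {u : Tm} (h : ∀ f s, M (val A) s → M (val B) (u.subst (scons s f))) :
    M (val (.arr A B)) (.lam u) := by
  have su : SN u := by
    have := h (· + 1) _ (M_var _ 0); rw [scons_id] at this; exact M_sn this
  induction su with
  | intro u _ ih =>
  refine M_fold ⟨?_, u, rfl, h⟩
  intro t' ht
  cases ht with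
  | base h => rcases h with h | h <;> cases h
  | lam hs => exact ih _ hs (fun f s hs' => M_step (h f s hs') (step_subst hs _))

theorem M_pair {A B : Ty} {a b : Tm} (ha : M (val A) a) (hb : M (val B) b) :
    M (val (.prod A B)) (.pair a b) := by
  have sa := M_sn ha
  induction sa generalizing b with
  | intro a _ iha =>
  have sb := M_sn hb
  induction sb with
  | intro b _ ihb =>
  refine M_fold ⟨?_, a, b, rfl, ha, hb⟩
  intro t' ht
  cases ht with
  | base h => rcases h with h | h <;> cases h
  | pairL hs => exact iha _ hs (M_step ha hs) hb
  | pairR hs => exact ihb _ hs (M_step hb hs)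

theorem M_inl {A B : Ty} {a : Tm} (ha : M (val A) a) : M (val (.sum A B)) (.inl a) := by
  have sa := M_sn ha
  induction sa with
  | intro a _ iha =>
  refine M_fold ⟨?_, ha⟩
  intro t' ht
  cases ht with
  | base h => rcases h with h | h <;> cases h
  | inl hs => exact iha _ hs (M_step ha hs)

theorem M_inr {A B : Ty} {a : Tm} (ha : M (val B) a) : M (val (.sum A B)) (.inr a) := by
  have sa := M_sn ha
  induction sa with
  | intro a _ iha =>
  refine M_fold ⟨?_, ha⟩
  intro t' ht
  cases ht with
  | base h => rcases h with h | h <;> cases h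
  | inr hs => exact iha _ hs (M_step ha hs)

theorem M_app {A B : Ty} {t s : Tm} (ht : M (val (.arr A B)) t) (hs : M (val A) s) :
    M (val B) (.app t s) := by
  refine M_ind (X := fun V t => V = val (.arr A B) → ∀ s, M (val A) s → M (val B) (.app t s))
    ?_ ht rfl s hs
  clear ht hs t s
  intro V t hm hV s hs
  subst hV
  have ss := M_sn hs
  induction ss with
  | intro s _ ihs =>
  refine M_fold ⟨?_, trivial⟩
  intro t' ht
  cases ht with
  | base h =>
    rcases h with h | h
    · cases h with
      | beta =>
        obtain ⟨u, e, h⟩ := hm.2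
        cases e
        rw [subst1_eq]; exact h _ _ hs
    · cases h with
      | appCase =>
        obtain ⟨P, Q, hP, hQ, h1, h2, h3⟩ := hm.2
        refine M_case h1.1 hP hQ (fun f w hw => ?_) (fun f w hw => ?_)
        · simp only [subst_app, up_scons]
          exact (h2 f w hw).2 rfl _ (M_rename hs (val_ren A) f)
        · simp only [subst_app, up_scons]
          exact (h3 f w hw).2 rfl _ (M_rename hs (val_ren A) f)
  | appL h => exact (hm.1 _ h).2 rfl s hs
  | appR h => exact ihs _ h (M_step hs h)

theorem M_proj1 {A B : Ty} {t : Tm} (ht : M (val (.prod A B)) t) : M (val A) (.proj1 t) := by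
  refine M_ind (X := fun V t => V = val (.prod A B) → M (val A) (.proj1 t)) ?_ ht rfl
  clear ht t
  intro V t hm hV
  subst hV
  refine M_fold ⟨?_, trivial⟩
  intro t' ht
  cases ht with
  | base h =>
    rcases h with h | h
    · cases h with
      | projPair1 =>
        obtain ⟨a, b, e, h1, h2⟩ := hm.2
        cases e
        exact h1
    · cases h with
      | proj1Case =>
        obtain ⟨P, Q, hP, hQ, h1, h2, h3⟩ := hm.2
        refine M_case h1.1 hP hQ (fun f w hw => ?_) (fun f w hw => ?_)
        · rw [subst_proj1]; exact (h2 f w hw).2 rfl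
        · rw [subst_proj1]; exact (h3 f w hw).2 rfl
  | proj1 h => exact (hm.1 _ h).2 rfl

theorem M_proj2 {A B : Ty} {t : Tm} (ht : M (val (.prod A B)) t) : M (val B) (.proj2 t) := by
  refine M_ind (X := fun V t => V = val (.prod A B) → M (val B) (.proj2 t)) ?_ ht rfl
  clear ht t
  intro V t hm hV
  subst hV
  refine M_fold ⟨?_, trivial⟩
  intro t' ht
  cases ht with
  | base h =>
    rcases h with h | h
    · cases h with
      | projPair2 =>
        obtain ⟨a, b, e, h1, h2⟩ := hm.2
        cases e
        exact h2
    · cases h with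
      | proj2Case =>
        obtain ⟨P, Q, hP, hQ, h1, h2, h3⟩ := hm.2
        refine M_case h1.1 hP hQ (fun f w hw => ?_) (fun f w hw => ?_)
        · rw [subst_proj2]; exact (h2 f w hw).2 rfl
        · rw [subst_proj2]; exact (h3 f w hw).2 rfl
  | proj2 h => exact (hm.1 _ h).2 rfl

/-- Reducible substitutions. -/
def RS (Γ : List Ty) (σ : ℕ → Tm) : Prop := ∀ n A, Γ[n]? = some A → M (val A) (σ n)

theorem RS_cons {Γ : List Ty} {σ : ℕ → Tm} (h : RS Γ σ) {A : Ty} {s : Tm} (hs : M (val A) s)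
    (f : ℕ → ℕ) : RS (A :: Γ) (fun j => (liftSub 1 σ j).subst (scons s f)) := by
  intro n B hB
  cases n with
  | zero => simp at hB; subst hB; simpa [liftSub, scons] using hs
  | succ n =>
    simp at hB
    simp only [liftSub, Nat.not_lt_zero, Nat.add_lt_iff_lt_sub_right, if_false,
      Nat.add_sub_cancel, Nat.sub_self, up_scons]
    exact M_rename (h n B hB) (val_ren B) f

theorem fundamental {Γ : List Ty} {t : Tm} {A : Ty} (h : Typing Γ t A) :
    ∀ σ, RS Γ σ → M (val A) (t.subst σ) := by
  induction h with
  | var h => intro σ hσ; simpa using hσ _ _ h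
  | lam _ ih =>
    intro σ hσ
    rw [subst_lam]
    refine M_lam fun f s hs => ?_
    rw [subst_subst]; exact ih _ (RS_cons hσ hs f)
  | app _ _ ih1 ih2 => intro σ hσ; rw [subst_app]; exact M_app (ih1 σ hσ) (ih2 σ hσ)
  | pair _ _ ih1 ih2 => intro σ hσ; rw [subst_pair]; exact M_pair (ih1 σ hσ) (ih2 σ hσ)
  | proj1 _ ih => intro σ hσ; rw [subst_proj1]; exact M_proj1 (ih σ hσ)
  | proj2 _ ih => intro σ hσ; rw [subst_proj2]; exact M_proj2 (ih σ hσ)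
  | inl _ ih => intro σ hσ; rw [subst_inl]; exact M_inl (ih σ hσ)
  | inr _ ih => intro σ hσ; rw [subst_inr]; exact M_inr (ih σ hσ)
  | case _ _ _ ih1 ih2 ih3 =>
    intro σ hσ
    rw [subst_case]
    refine M_case (ih1 σ hσ) (val_cand _) (val_cand _) (fun f w hw => ?_) (fun f w hw => ?_)
    · rw [subst_subst]; exact ih2 _ (RS_cons hσ hw f)
    · rw [subst_subst]; exact ih3 _ (RS_cons hσ hw f)
  | @box Γ ts s As B hlen _ _ ih1 ih2 =>
    intro σ hσ
    rw [subst_box]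
    let L : List (Pd × Tm) := (List.zip ts As).map (fun p => (M (val p.2), p.1.subst σ))
    have e1 : ts.map (Tm.subst σ) = L.map Prod.snd := by
      have : ts = (List.zip ts As).map Prod.fst := by
        rw [List.map_fst_zip (le_of_eq hlen)]
      conv_lhs => rw [this]
      simp [L]
    have e2 : L.length = ts.length := by simp [L, hlen]
    have e3 : L.map Prod.fst = As.map (fun A => M (val A)) := by
      have : As = (List.zip ts As).map Prod.snd := by
        rw [List.map_snd_zip (ge_of_eq hlen)]
      conv_rhs => rw [this]
      simp [L]
    rw [e1]
    refine M_box (val_cand B) ?_ ?_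
    · intro e he
      obtain ⟨p, hp, rfl⟩ := List.mem_map.1 he
      exact ⟨val_cand _, ih1 p hp σ hσ⟩
    · intro τ f h1 h2
      rw [subst_subst]
      refine ih2 _ ?_
      intro n C hC
      by_cases hn : n < ts.length
      · rw [List.getElem?_append_left (by simp; omega)] at hC
        have : (L.reverse.map Prod.fst)[n]? = some (M (val C)) := by
          rw [List.map_reverse, e3, ← List.map_reverse, List.getElem?_map, hC]; rfl
        rw [List.getElem?_map, Option.map_eq_some_iff] at this
        obtain ⟨e, he, hee⟩ := this
        have := h1 n e he
        rw [hee] at this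
        simpa [liftSub, hn] using this
      · rw [List.getElem?_append_right (by simp; omega)] at hC
        have h3 : ∀ x : Tm, (x.rename (· + ts.length)).subst τ = x.rename f := by
          intro x
          rw [subst_rename, rename_eq_subst]; congr 1; funext j; rw [← h2, e2]
        simp only [liftSub, hn, if_false, h3]
        refine M_rename (hσ _ _ ?_) (val_ren C) f
        rw [← hC]; simp [hlen]

/-- **Strong normalization of combined detour and permutation reduction** on well-typed
terms: there is no infinite sequence of `>_D`- and `>_P`-steps starting from a term typable
in some context. -/
theorem strong_normalization_detour_perm :
    ∀ t : Tm, (∃ Γ A, Typing Γ t A) → Acc (fun a b : Tm => StepDP b a) t := by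
  rintro t ⟨Γ, A, h⟩
  have hM := fundamental h Tm.var (fun n A _ => M_var _ n)
  rw [subst_id] at hM
  have hs := M_sn hM
  exact Subrelation.accessible (fun {a b} hab => stepDP_step hab) hs


end IEL
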